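/- There is a constant C such that for all v ∈ 𝓢(ℝ³;ℝ³): ∫_{ℝ³} |∇²v|² |∇v| dy ≤ C ‖∇v‖_{L²(ℝ³)} ‖Δv‖_{L²(ℝ³)}^{1/2} ‖∇Δv‖_{L²(ℝ³)}^{3/2}. -/

import Mathlib

open MeasureTheory

open scoped LineDeriv SchwartzMap

/-- shorthand for the space. -/
abbrev E3 : Type := EuclideanSpace ℝ (Fin 3)

/-- partial derivative of a Schwartz function. -/
noncomputable def pd (i : Fin 3) (f : 𝓢(E3, E3)) : 𝓢(E3, E3) :=
  LineDeriv.lineDerivOp (EuclideanSpace.single i (1:ℝ) : E3) f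

lemma pd_apply (i : Fin 3) (f : 𝓢(E3, E3)) (x : E3) :
    pd i f x = fderiv ℝ f x (EuclideanSpace.single i 1) := rfl

lemma pd_fun (i : Fin 3) (f : 𝓢(E3, E3)) :
    (pd i f : E3 → E3) = fun x => fderiv ℝ f x (EuclideanSpace.single i 1) := rfl

lemma pd_sum {ι : Type*} (s : Finset ι) (i : Fin 3) (f : ι → 𝓢(E3, E3)) :
    pd i (∑ k ∈ s, f k) = ∑ k ∈ s, pd i (f k) := by
  unfold pd
  exact map_sum (LineDeriv.lineDerivOpCLM ℝ 𝓢(E3, E3) (EuclideanSpace.single i (1:ℝ) : E3)) f s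

lemma pd_pd_apply (i j : Fin 3) (f : 𝓢(E3, E3)) (x : E3) :
    pd i (pd j f) x = fderiv ℝ (fderiv ℝ f) x (EuclideanSpace.single i 1)
      (EuclideanSpace.single j 1) := by
  rw [pd_apply, pd_fun]
  have h : DifferentiableAt ℝ (fderiv ℝ f) x :=
    (SchwartzMap.fderivCLM ℝ E3 E3 f).differentiableAt
  rw [fderiv_clm_apply h (differentiableAt_const _)]
  simp

lemma pd_comm (i j : Fin 3) (f : 𝓢(E3, E3)) : pd i (pd j f) = pd j (pd i f) := by
  ext1 x
  rw [pd_pd_apply, pd_pd_apply]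
  have h : ContDiffAt ℝ 2 f x := (f.smooth 2).contDiffAt
  exact (h.isSymmSndFDerivAt (by simp)) _ _

lemma norm_le_sum_basis {F : Type*} [NormedAddCommGroup F] [NormedSpace ℝ F] (L : E3 →L[ℝ] F) :
    ‖L‖ ≤ ∑ i : Fin 3, ‖L (EuclideanSpace.single i 1)‖ := by
  refine L.opNorm_le_bound (by positivity) fun x => ?_
  have hx : x = ∑ i : Fin 3, x i • (EuclideanSpace.single i (1:ℝ) : E3) := by
    ext k
    simp [Pi.single_apply]
  conv_lhs => rw [hx, map_sum]
  refine (norm_sum_le _ _).trans ?_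
  rw [Finset.sum_mul]
  refine Finset.sum_le_sum fun i _ => ?_
  rw [map_smul, norm_smul, mul_comm]
  gcongr
  exact PiLp.norm_apply_le x i

lemma norm_iter_two_le (f : 𝓢(E3, E3)) (x : E3) :
    ‖iteratedFDeriv ℝ 2 f x‖ ≤ ∑ i : Fin 3, ∑ j : Fin 3, ‖pd i (pd j f) x‖ := by
  have : ‖iteratedFDeriv ℝ 2 f x‖ = ‖fderiv ℝ (fderiv ℝ f) x‖ := by
    rw [← norm_iteratedFDeriv_fderiv, norm_iteratedFDeriv_one]
  rw [this]
  refine (norm_le_sum_basis _).trans (Finset.sum_le_sum fun i _ => ?_)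
  refine (norm_le_sum_basis _).trans (Finset.sum_le_sum fun j _ => ?_)
  rw [pd_pd_apply]

lemma cs_int {f g : E3 → ℝ} (hf0 : ∀ x, 0 ≤ f x) (hg0 : ∀ x, 0 ≤ g x)
    (hf : MemLp f 2) (hg : MemLp g 2) :
    ∫ x, f x * g x ≤ √(∫ x, f x ^ 2) * √(∫ x, g x ^ 2) := by
  have h := integral_mul_le_Lp_mul_Lq_of_nonneg (μ := (volume : Measure E3))
    Real.HolderConjugate.two_two
    (Filter.Eventually.of_forall hf0) (Filter.Eventually.of_forall hg0)
    (by simpa using hf) (by simpa using hg)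
  simpa [Real.sqrt_eq_rpow] using h

lemma sch_pow_int {F : Type*} [NormedAddCommGroup F] [NormedSpace ℝ F] (f : 𝓢(E3, F))
    {n : ℕ} (hn : n ≠ 0) :
    Integrable (fun x => ‖f x‖ ^ n) := (f.memLp n).integrable_norm_pow hn

lemma sch_pow_memLp {F : Type*} [NormedAddCommGroup F] [NormedSpace ℝ F] (f : 𝓢(E3, F))
    {n : ℕ} (hn : n ≠ 0) :
    MemLp (fun x => ‖f x‖ ^ n) 2 := by
  refine (memLp_two_iff_integrable_sq (f := fun x => ‖f x‖ ^ n) (μ := volume)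
    ((f.continuous.norm.pow n).aestronglyMeasurable)).2 ?_
  simp_rw [← pow_mul]
  exact sch_pow_int f (by omega)

/-- The Laplacian. -/
noncomputable def lap (f : 𝓢(E3, E3)) : 𝓢(E3, E3) := ∑ j : Fin 3, pd j (pd j f)

lemma lap_pd (i : Fin 3) (f : 𝓢(E3, E3)) : lap (pd i f) = pd i (lap f) := by
  unfold lap
  rw [pd_sum]
  refine Finset.sum_congr rfl fun j _ => ?_
  rw [pd_comm j i f, pd_comm j i]

lemma ibp (i : Fin 3) (f g : 𝓢(E3, E3)) :
    ∫ x, inner ℝ (f x) (pd i g x) = - ∫ x, inner ℝ (pd i f x) (g x) :=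
  SchwartzMap.integral_bilinear_lineDerivOp_right_eq_neg_left f g (innerSL ℝ) _

lemma inner_int (f g : 𝓢(E3, E3)) : Integrable (fun x => (inner ℝ (f x) (g x) : ℝ)) :=
  (SchwartzMap.pairing (innerSL ℝ) f g).integrable

lemma pdpd_sq (i j : Fin 3) (f : 𝓢(E3, E3)) :
    ∫ x, ‖pd i (pd j f) x‖ ^ 2 = ∫ x, inner ℝ (pd i (pd i f) x) (pd j (pd j f) x) := by
  simp_rw [← real_inner_self_eq_norm_sq]
  rw [ibp i, pd_comm i j f, pd_comm i j, ← ibp j]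

lemma sum_pdpd (f : 𝓢(E3, E3)) :
    ∑ i : Fin 3, ∑ j : Fin 3, ∫ x, ‖pd i (pd j f) x‖ ^ 2 = ∫ x, ‖lap f x‖ ^ 2 := by
  simp_rw [pdpd_sq, ← real_inner_self_eq_norm_sq]
  simp_rw [lap, sum_apply, sum_inner, inner_sum]
  rw [integral_finsetSum _ fun i _ => integrable_finsetSum _ fun j _ => inner_int _ _]
  refine Finset.sum_congr rfl fun i _ => ?_
  rw [integral_finsetSum _ fun j _ => inner_int _ _]

lemma pdpd_le (i j : Fin 3) (f : 𝓢(E3, E3)) :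
    ∫ x, ‖pd i (pd j f) x‖ ^ 2 ≤ ∫ x, ‖lap f x‖ ^ 2 := by
  rw [← sum_pdpd]
  have h0 : ∀ i j : Fin 3, 0 ≤ ∫ x, ‖pd i (pd j f) x‖ ^ 2 := fun i j =>
    integral_nonneg fun x => by positivity
  refine le_trans ?_ (Finset.single_le_sum (f := fun i => ∑ j : Fin 3, ∫ x, ‖pd i (pd j f) x‖ ^ 2)
    (fun i _ => Finset.sum_nonneg fun j _ => h0 i j) (Finset.mem_univ i))
  exact Finset.single_le_sum (f := fun j => ∫ x, ‖pd i (pd j f) x‖ ^ 2)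
    (fun j _ => h0 i j) (Finset.mem_univ j)

lemma grad_le (i j : Fin 3) (f : 𝓢(E3, E3)) :
    ∫ x, ‖fderiv ℝ (pd i (pd j f)) x‖ ^ 2 ≤ 9 * ∫ x, ‖fderiv ℝ (lap f) x‖ ^ 2 := by
  have h1 : ∀ k, ∫ x, ‖pd k (pd i (pd j f)) x‖ ^ 2 ≤ ∫ x, ‖fderiv ℝ (lap f) x‖ ^ 2 := by
    intro k
    rw [pd_comm k i, pd_comm k j]
    refine (pdpd_le i j _).trans ?_
    rw [lap_pd]
    refine integral_mono (sch_pow_int _ two_ne_zero)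
      (sch_pow_int (SchwartzMap.fderivCLM ℝ E3 E3 (lap f)) two_ne_zero) fun x => ?_
    have := (fderiv ℝ (lap f) x).le_opNorm (EuclideanSpace.single k 1)
    simp only [PiLp.norm_single, norm_one, mul_one] at this
    dsimp only
    rw [pd_apply]
    gcongr
  calc ∫ x, ‖fderiv ℝ (pd i (pd j f)) x‖ ^ 2
      ≤ ∫ x, 3 * ∑ k : Fin 3, ‖pd k (pd i (pd j f)) x‖ ^ 2 := by
        refine integral_mono
          (sch_pow_int (SchwartzMap.fderivCLM ℝ E3 E3 (pd i (pd j f))) two_ne_zero)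
          ((integrable_finsetSum _ fun k _ => sch_pow_int _ two_ne_zero).const_mul _) fun x => ?_
        have h := norm_le_sum_basis (fderiv ℝ (pd i (pd j f)) x)
        have h' := pow_le_pow_left₀ (norm_nonneg _) h 2
        refine h'.trans ?_
        refine (sq_sum_le_card_mul_sum_sq).trans ?_
        simp [pd_apply]
    _ = 3 * ∑ k : Fin 3, ∫ x, ‖pd k (pd i (pd j f)) x‖ ^ 2 := by
        rw [integral_const_mul, integral_finsetSum _ fun k _ => sch_pow_int (pd k (pd i (pd j f))) two_ne_zero]
    _ ≤ 3 * ∑ k : Fin 3, ∫ x, ‖fderiv ℝ (lap f) x‖ ^ 2 := by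
        exact mul_le_mul_of_nonneg_left (Finset.sum_le_sum fun k _ => h1 k) (by norm_num)
    _ = _ := by simp; ring

lemma cutoff : ∃ (χ : ℕ → E3 → ℝ) (K : NNReal), (∀ n, ContDiff ℝ 1 (χ n)) ∧
    (∀ n, HasCompactSupport (χ n)) ∧ (∀ n x, ‖χ n x‖ ≤ 1) ∧
    (∀ n x, ‖fderiv ℝ (χ n) x‖ ≤ (K : ℝ) * (1 / ((n : ℝ) + 1))) ∧
    (∀ x, Filter.Tendsto (fun n => χ n x) Filter.atTop (nhds 1)) := by
  let b : ContDiffBump (0 : E3) := ⟨1, 2, by norm_num, by norm_num⟩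
  have hb : ContDiff ℝ 1 b := b.contDiff
  obtain ⟨K, hK⟩ := (hb.continuous_fderiv (by norm_num)).bounded_above_of_compact_support
    (b.hasCompactSupport.fderiv (𝕜 := ℝ))
  have hpos : ∀ n : ℕ, (0:ℝ) < 1 / ((n : ℝ) + 1) := fun n => by positivity
  refine ⟨fun n x => b ((1 / ((n : ℝ) + 1)) • x), K.toNNReal, fun n => ?_, fun n => ?_,
    fun n x => ?_, fun n x => ?_, fun x => ?_⟩
  · exact hb.comp (contDiff_const_smul _)
  · exact b.hasCompactSupport.comp_smul (hpos n).ne'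
  · rw [Real.norm_of_nonneg b.nonneg]; exact b.le_one
  · have hd : HasFDerivAt (fun y : E3 => (1 / ((n : ℝ) + 1)) • y)
        ((1 / ((n : ℝ) + 1)) • ContinuousLinearMap.id ℝ E3) x :=
      (hasFDerivAt_id x).fun_const_smul (1 / ((n : ℝ) + 1))
    have h2 := ((hb.differentiable (by norm_num)) ((1 / ((n : ℝ) + 1)) • x)).hasFDerivAt.comp x hd
    have h3 : fderiv ℝ (fun y : E3 => b ((1 / ((n : ℝ) + 1)) • y)) x =
      (1 / ((n : ℝ) + 1)) • fderiv ℝ b ((1 / ((n : ℝ) + 1)) • x) := by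
      refine h2.fderiv.trans ?_
      ext y; simp
    rw [h3, norm_smul, Real.norm_of_nonneg (hpos n).le, mul_comm]
    gcongr
    exact (hK _).trans (Real.le_coe_toNNReal K)
  · refine tendsto_const_nhds.congr' ?_
    have h0 : Filter.Tendsto (fun n : ℕ => (1 / ((n : ℝ) + 1)) • x) Filter.atTop (nhds 0) := by
      simpa using (tendsto_one_div_add_atTop_nhds_zero_nat (𝕜 := ℝ)).smul_const x
    filter_upwards [h0 (Metric.closedBall_mem_nhds 0 one_pos)] with n hn
    exact (b.one_of_mem_closedBall hn).symm

lemma sobolev_c : ∃ C : NNReal, ∀ u : E3 → E3, ContDiff ℝ 1 u → HasCompactSupport u →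
    eLpNorm u 6 volume ≤ C * eLpNorm (fderiv ℝ u) 2 volume := by
  refine ⟨SNormLESNormFDerivOfEqConst E3 (volume : Measure E3) ((2 : NNReal) : ℝ),
    fun u hu hc => ?_⟩
  have := eLpNorm_le_eLpNorm_fderiv_of_eq (F := E3) (volume : Measure E3)
      hu hc (p := 2) (p' := 6) (by norm_num) (by simp) (by simp; norm_num)
  simpa only [ENNReal.coe_ofNat] using this

lemma sobolev_e : ∃ C : NNReal, ∀ w : 𝓢(E3, E3),
    eLpNorm w 6 volume ≤ C * eLpNorm (fderiv ℝ w) 2 volume := by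
  obtain ⟨χ, K, hc, hcs, h1, hd, ht⟩ := cutoff
  obtain ⟨C, hC⟩ := sobolev_c
  refine ⟨C, fun w => ?_⟩
  have hw : ContDiff ℝ 1 w := w.smooth 1
  have hwd : Continuous (fderiv ℝ w) := (SchwartzMap.fderivCLM ℝ E3 E3 w).continuous
  have hb : ∀ n : ℕ, eLpNorm (fun x => χ n x • w x) 6 volume ≤
      C * (eLpNorm (fderiv ℝ w) 2 volume +
        ENNReal.ofReal ((K : ℝ) * (1 / ((n : ℝ) + 1))) * eLpNorm w 2 volume) := by
    intro n
    have := hC (fun x => χ n x • w x) ((hc n).smul hw) ((hcs n).smul_right)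
    refine this.trans ?_
    gcongr
    have hf : fderiv ℝ (fun x => χ n x • w x) =
        (fun x => χ n x • fderiv ℝ w x) + fun x => (fderiv ℝ (χ n) x).smulRight (w x) := by
      ext1 x
      exact fderiv_fun_smul ((hc n).differentiable (by norm_num) x) w.differentiableAt
    rw [hf]
    have hcd := (hc n).continuous_fderiv (by norm_num)
    refine (eLpNorm_add_le (((hc n).continuous.smul hwd).aestronglyMeasurable) ?_
      (by norm_num)).trans ?_
    · refine Continuous.aestronglyMeasurable ?_
      have := w.continuous
      fun_prop
    gcongr
    · refine eLpNorm_mono fun x => ?_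
      change ‖χ n x • fderiv ℝ w x‖ ≤ _
      rw [norm_smul]
      exact mul_le_of_le_one_left (norm_nonneg _) (h1 n x)
    · refine eLpNorm_le_mul_eLpNorm_of_ae_le_mul (Filter.Eventually.of_forall fun x => ?_) 2
      rw [ContinuousLinearMap.norm_smulRight_apply]
      gcongr
      exact hd n x
  have hlim := Lp.eLpNorm_lim_le_liminf_eLpNorm (p := 6) (μ := (volume : Measure E3))
    (f := fun n x => χ n x • w x)
    (fun n => ((hc n).continuous.smul w.continuous).aestronglyMeasurable) w
    (Filter.Eventually.of_forall fun x => by simpa using (ht x).smul_const (w x))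
  refine hlim.trans ?_
  refine (Filter.liminf_le_liminf (Filter.Eventually.of_forall hb)).trans (le_of_eq ?_)
  refine Filter.Tendsto.liminf_eq ?_
  have h0 : Filter.Tendsto (fun n : ℕ => ENNReal.ofReal ((K : ℝ) * (1 / ((n : ℝ) + 1))))
      Filter.atTop (nhds 0) := by
    have := ENNReal.tendsto_ofReal
      ((tendsto_one_div_add_atTop_nhds_zero_nat (𝕜 := ℝ)).const_mul (K : ℝ))
    simpa using this
  have h2 := ENNReal.Tendsto.mul_const (b := eLpNorm w 2 volume) h0
    (Or.inr (w.memLp 2 volume).eLpNorm_ne_top)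
  have h3 := ENNReal.Tendsto.const_mul (a := (C : ENNReal))
    ((tendsto_const_nhds (x := eLpNorm (fderiv ℝ w) 2 volume)).add h2)
    (Or.inr ENNReal.coe_ne_top)
  simpa using h3

lemma sobolev6 : ∃ K : ℝ, 0 ≤ K ∧ ∀ w : 𝓢(E3, E3),
    ∫ x, ‖w x‖ ^ 6 ≤ K * (∫ x, ‖fderiv ℝ w x‖ ^ 2) ^ 3 := by
  obtain ⟨C, hC⟩ := sobolev_e
  refine ⟨(C : ℝ) ^ 6, by positivity, fun w => ?_⟩
  have h := hC w
  have hm : MemLp (fderiv ℝ w) 2 volume := (SchwartzMap.fderivCLM ℝ E3 E3 w).memLp 2 volume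
  rw [(w.memLp 6 volume).eLpNorm_eq_integral_rpow_norm (by norm_num) (by norm_num),
    hm.eLpNorm_eq_integral_rpow_norm (by norm_num) (by norm_num),
    ← ENNReal.ofReal_coe_nnreal, ← ENNReal.ofReal_mul (by positivity),
    ENNReal.ofReal_le_ofReal_iff (by positivity)] at h
  have e6 : (6 : ENNReal).toReal = ((6 : ℕ) : ℝ) := by norm_num
  have e2 : (2 : ENNReal).toReal = ((2 : ℕ) : ℝ) := by norm_num
  simp_rw [e6, e2, Real.rpow_natCast] at h
  have hI : 0 ≤ ∫ x, ‖w x‖ ^ 6 := integral_nonneg fun x => by positivity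
  have hJ : 0 ≤ ∫ x, ‖fderiv ℝ w x‖ ^ 2 := integral_nonneg fun x => by positivity
  have h6 := pow_le_pow_left₀ (by positivity) h 6
  rw [mul_pow, ← Real.rpow_mul_natCast hI, ← Real.rpow_mul_natCast hJ] at h6
  norm_num at h6
  exact_mod_cast h6

lemma l4 : ∃ M : ℝ, 0 ≤ M ∧ ∀ f : 𝓢(E3, E3), ∀ i j : Fin 3,
    ∫ x, ‖pd i (pd j f) x‖ ^ 4 ≤
      M * (√(∫ x, ‖lap f x‖ ^ 2) * √(∫ x, ‖fderiv ℝ (lap f) x‖ ^ 2) ^ 3) := by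
  obtain ⟨K, hK, hs⟩ := sobolev6
  refine ⟨√(K * 9 ^ 3), by positivity, fun f i j => ?_⟩
  set w := pd i (pd j f) with hw
  have hB : 0 ≤ ∫ x, ‖fderiv ℝ (lap f) x‖ ^ 2 := integral_nonneg fun x => by positivity
  have h1 := cs_int (f := fun x => ‖w x‖ ^ 1) (g := fun x => ‖w x‖ ^ 3)
    (fun x => by positivity) (fun x => by positivity) (sch_pow_memLp w one_ne_zero)
    (sch_pow_memLp w three_ne_zero)
  simp_rw [← pow_mul, ← pow_add] at h1
  norm_num at h1
  refine h1.trans ?_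
  have h2 : √(∫ x, ‖w x‖ ^ 6) ≤ √(K * 9 ^ 3) * √(∫ x, ‖fderiv ℝ (lap f) x‖ ^ 2) ^ 3 := by
    have : √(∫ x, ‖fderiv ℝ (lap f) x‖ ^ 2) ^ 3 = √((∫ x, ‖fderiv ℝ (lap f) x‖ ^ 2) ^ 3) := by
      rw [Real.sqrt_eq_rpow, Real.sqrt_eq_rpow, ← Real.rpow_mul_natCast hB,
        ← Real.rpow_natCast_mul hB]
      norm_num
    rw [this, ← Real.sqrt_mul (by positivity)]
    refine Real.sqrt_le_sqrt ((hs w).trans ?_)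
    rw [mul_assoc, ← mul_pow]
    gcongr
    exact grad_le i j f
  have h3 : √(∫ x, ‖w x‖ ^ 2) ≤ √(∫ x, ‖lap f x‖ ^ 2) := Real.sqrt_le_sqrt (pdpd_le i j f)
  calc _ ≤ _ := mul_le_mul h3 h2 (by positivity) (by positivity)
    _ = _ := by ring

lemma hess_memLp (v : 𝓢(E3, E3)) : MemLp (fun x => ‖iteratedFDeriv ℝ 2 v x‖ ^ 2) 2 := by
  have := sch_pow_memLp (SchwartzMap.fderivCLM ℝ E3 _ (SchwartzMap.fderivCLM ℝ E3 E3 v)) two_ne_zero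
  convert this using 3 with x
  rw [← norm_iteratedFDeriv_fderiv, norm_iteratedFDeriv_one]
  rfl

lemma hess4 : ∃ M : ℝ, 0 ≤ M ∧ ∀ f : 𝓢(E3, E3),
    ∫ x, ‖iteratedFDeriv ℝ 2 f x‖ ^ 4 ≤
      M * (√(∫ x, ‖lap f x‖ ^ 2) * √(∫ x, ‖fderiv ℝ (lap f) x‖ ^ 2) ^ 3) := by
  obtain ⟨M, hM, h⟩ := l4
  refine ⟨3 ^ 8 * M, by positivity, fun f => ?_⟩
  have hi : Integrable fun x => ‖iteratedFDeriv ℝ 2 f x‖ ^ 4 := by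
    have := (hess_memLp f).integrable_sq
    simpa [← pow_mul] using this
  have hs : ∀ (a : Fin 3 → ℝ), (∀ i, 0 ≤ a i) → (∑ i, a i) ^ 4 ≤ 3 ^ 3 * ∑ i, a i ^ 4 := by
    intro a ha
    have h1 : (∑ i, a i) ^ 2 ≤ 3 * ∑ i, a i ^ 2 := by
      simpa using sq_sum_le_card_mul_sum_sq (s := Finset.univ) (f := a)
    have h2 : (∑ i, a i ^ 2) ^ 2 ≤ 3 * ∑ i, a i ^ 4 := by
      have := sq_sum_le_card_mul_sum_sq (s := Finset.univ) (f := fun i => a i ^ 2)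
      simp_rw [← pow_mul] at this
      simpa using this
    have h3 := pow_le_pow_left₀ (by positivity) h1 2
    nlinarith [h3, h2]
  calc ∫ x, ‖iteratedFDeriv ℝ 2 f x‖ ^ 4
      ≤ ∫ x, 3 ^ 6 * ∑ i : Fin 3, ∑ j : Fin 3, ‖pd i (pd j f) x‖ ^ 4 := by
        refine integral_mono hi ((integrable_finsetSum _ fun i _ => integrable_finsetSum _ fun j _ =>
          sch_pow_int _ four_ne_zero).const_mul _) fun x => ?_
        refine (pow_le_pow_left₀ (norm_nonneg _) (norm_iter_two_le f x) 4).trans ?_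
        refine (hs _ fun i => by positivity).trans ?_
        have : ∀ i : Fin 3, (∑ j : Fin 3, ‖pd i (pd j f) x‖) ^ 4 ≤
          3 ^ 3 * ∑ j : Fin 3, ‖pd i (pd j f) x‖ ^ 4 := fun i => hs _ fun j => by positivity
        calc _ ≤ 3 ^ 3 * ∑ i : Fin 3, (3 ^ 3 * ∑ j : Fin 3, ‖pd i (pd j f) x‖ ^ 4) := by
              gcongr with i; exact this i
          _ = _ := by rw [← Finset.mul_sum, ← mul_assoc]; norm_num
    _ = 3 ^ 6 * ∑ i : Fin 3, ∑ j : Fin 3, ∫ x, ‖pd i (pd j f) x‖ ^ 4 := by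
        rw [integral_const_mul, integral_finsetSum _ fun i _ => integrable_finsetSum _ fun j _ =>
          sch_pow_int _ four_ne_zero]
        congr 1
        refine Finset.sum_congr rfl fun i _ => ?_
        rw [integral_finsetSum _ fun j _ => sch_pow_int _ four_ne_zero]
    _ ≤ 3 ^ 6 * ∑ i : Fin 3, ∑ j : Fin 3,
        M * (√(∫ x, ‖lap f x‖ ^ 2) * √(∫ x, ‖fderiv ℝ (lap f) x‖ ^ 2) ^ 3) := by
        gcongr with i _ j
        exact h f i j
    _ = _ := by simp; ring

theorem stmt_13 : ∃ C : ℝ, 0 < C ∧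
    ∀ v : SchwartzMap (EuclideanSpace ℝ (Fin 3)) (EuclideanSpace ℝ (Fin 3)),
      (∫ y : EuclideanSpace ℝ (Fin 3), ‖iteratedFDeriv ℝ 2 (⇑v) y‖^2 * ‖fderiv ℝ (⇑v) y‖) ≤
        C * Real.sqrt (∫ y : EuclideanSpace ℝ (Fin 3), ‖fderiv ℝ (⇑v) y‖^2)
          * (Real.sqrt (∫ y : EuclideanSpace ℝ (Fin 3),
              ‖∑ j : Fin 3, fderiv ℝ (fun z => fderiv ℝ (⇑v) z (EuclideanSpace.single j 1)) y
                  (EuclideanSpace.single j 1)‖^2)) ^ ((1:ℝ)/2)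
          * (Real.sqrt (∫ y : EuclideanSpace ℝ (Fin 3),
              ‖fderiv ℝ (fun z => ∑ j : Fin 3,
                  fderiv ℝ (fun z' => fderiv ℝ (⇑v) z' (EuclideanSpace.single j 1)) z
                    (EuclideanSpace.single j 1)) y‖^2)) ^ ((3:ℝ)/2) := by
  obtain ⟨M, hM, h⟩ := hess4
  refine ⟨√M + 1, by positivity, fun v => ?_⟩
  have hl : (fun z => ∑ j : Fin 3,
      fderiv ℝ (fun z' => fderiv ℝ (⇑v) z' (EuclideanSpace.single j 1)) z
        (EuclideanSpace.single j 1)) = lap v := by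
    ext1 x
    rw [lap, sum_apply]
    rfl
  have hl' : ∀ z, ∑ j : Fin 3,
      fderiv ℝ (fun z' => fderiv ℝ (⇑v) z' (EuclideanSpace.single j 1)) z
        (EuclideanSpace.single j 1) = lap v z := fun z => congrFun hl z
  rw [hl]
  simp_rw [hl']
  have hg : MemLp (fun x => ‖fderiv ℝ v x‖) 2 := by
    simpa using sch_pow_memLp (SchwartzMap.fderivCLM ℝ E3 E3 v) one_ne_zero
  refine (cs_int (fun x => by positivity) (fun x => by positivity) (hess_memLp v) hg).trans ?_
  simp_rw [← pow_mul]
  norm_num only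
  set A := √(∫ x, ‖lap v x‖ ^ 2) with hA
  set B := √(∫ x, ‖fderiv ℝ (lap v) x‖ ^ 2) with hB
  have hA0 : 0 ≤ A := Real.sqrt_nonneg _
  have hB0 : 0 ≤ B := Real.sqrt_nonneg _
  have key : √(∫ x, ‖iteratedFDeriv ℝ 2 v x‖ ^ 4) ≤
      √M * (A ^ ((1:ℝ)/2) * B ^ ((3:ℝ)/2)) := by
    refine (Real.sqrt_le_sqrt (h v)).trans (le_of_eq ?_)
    rw [Real.sqrt_mul hM, Real.sqrt_mul hA0, Real.sqrt_eq_rpow A, Real.sqrt_eq_rpow (B ^ 3),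
      ← Real.rpow_natCast_mul hB0]
    norm_num
  calc _ ≤ (√M + 1) * (A ^ ((1:ℝ)/2) * B ^ ((3:ℝ)/2)) * √(∫ x, ‖fderiv ℝ v x‖ ^ 2) := by
        gcongr
        refine key.trans ?_
        gcongr
        linarith
    _ = _ := by ring
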